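/- For any full-rank n-dimensional lattice Λ ⊆ ℝ^n and any ε > 0, the smoothing parameter satisfies η_ε(Λ) ≤ √(ln(2n(1 + 1/ε))/π) · λ_n(Λ). -/

import Mathlib

open scoped BigOperators Real

noncomputable section

/-- The lattice generated by the columns of `B`. -/
def latticeSet {n : ℕ} (B : Matrix (Fin n) (Fin n) ℝ) : Set (Fin n → ℝ) :=
  {x | ∃ z : Fin n → ℤ, x = B.mulVec fun i => (z i : ℝ)}

/-- Euclidean norm on `ℝ^n`. -/
def enorm2 {n : ℕ} (x : Fin n → ℝ) : ℝ := Real.sqrt (∑ i, x i ^ 2)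

/-- The dual lattice: vectors with integer inner products with all lattice points. -/
def dualLattice {n : ℕ} (B : Matrix (Fin n) (Fin n) ℝ) : Set (Fin n → ℝ) :=
  {x | ∀ v ∈ latticeSet B, ∃ k : ℤ, (∑ i, x i * v i) = (k : ℝ)}

/-- Gaussian mass `ρ_{s,0}(S) = ∑_{x ∈ S} exp(−π‖x‖²/s²)` of a set `S ⊆ ℝ^n`. -/
def rhoOnSet {n : ℕ} (s : ℝ) (S : Set (Fin n → ℝ)) : ℝ :=
  ∑' x : S, Real.exp (-π * (∑ i, (x : Fin n → ℝ) i ^ 2) / s ^ 2)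

/-- The smoothing parameter `η_ε(L(B))`: the smallest `s > 0` such that
`ρ_{1/s,0}(L(B)* \ {0}) ≤ ε`. -/
def smoothingParam {n : ℕ} (B : Matrix (Fin n) (Fin n) ℝ) (ε : ℝ) : ℝ :=
  sInf {s : ℝ | 0 < s ∧ rhoOnSet (1 / s) (dualLattice B \ {0}) ≤ ε}

/-- The `n`-th successive minimum `λ_n(L(B))`: the smallest `r` such that the lattice
contains `n` linearly independent vectors of Euclidean norm at most `r`. -/
def lambdaN {n : ℕ} (B : Matrix (Fin n) (Fin n) ℝ) : ℝ :=
  sInf {r : ℝ | ∃ v : Fin n → (Fin n → ℝ),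
    LinearIndependent ℝ v ∧ ∀ i, v i ∈ latticeSet B ∧ enorm2 (v i) ≤ r}


lemma aux_le_one (G : ℤ → ℝ) (C : ℝ) (h0 : ∀ j, 0 ≤ G j) (hC : ∀ j, G j ≤ C)
    (h4 : ∀ j, G j ^ 4 ≤ G (2 * j)) (j : ℤ) : G j ≤ 1 := by
  by_contra! hlt
  have hk : ∀ k : ℕ, ∀ j, G j ^ (4 ^ k) ≤ G (2 ^ k * j) := by
    intro k
    induction k with
    | zero => intro j; simp
    | succ k ih =>
      intro j
      calc G j ^ (4 ^ (k+1)) = (G j ^ 4 ^ k) ^ 4 := by rw [← pow_mul, pow_succ]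
        _ ≤ (G (2 ^ k * j)) ^ 4 := by
          have := ih j
          have := pow_nonneg (h0 j) (4 ^ k)
          gcongr
        _ ≤ G (2 * (2 ^ k * j)) := h4 _
        _ = _ := by congr 1; ring
  obtain ⟨m, hm⟩ := pow_unbounded_of_one_lt C hlt
  have h1 : G j ^ m ≤ G j ^ (4 ^ m) :=
    pow_le_pow_right₀ hlt.le (Nat.lt_pow_self (by norm_num)).le
  linarith [hk m j, hC (2 ^ m * j)]

open scoped ENNReal

lemma cs_tsum {ι : Type*} (f g : ι → ℝ≥0∞) :
    (∑' i, f i * g i) ^ 2 ≤ (∑' i, f i ^ 2) * (∑' i, g i ^ 2) := by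
  let _ : MeasurableSpace ι := ⊤
  have h := ENNReal.lintegral_mul_le_Lp_mul_Lq (MeasureTheory.Measure.count (α := ι))
    (p := 2) (q := 2) (by constructor <;> norm_num) (f := f) (g := g)
    (measurable_from_top.aemeasurable) (measurable_from_top.aemeasurable)
  simp only [MeasureTheory.lintegral_count' measurable_from_top, Pi.mul_apply] at h
  have h2 := pow_le_pow_left₀ zero_le h 2
  refine h2.trans (le_of_eq ?_)
  rw [mul_pow, ← ENNReal.rpow_natCast, ← ENNReal.rpow_natCast, ← ENNReal.rpow_mul,
    ← ENNReal.rpow_mul]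
  norm_num

/-- mass of the fibre -/
def hE {M : Type*} [AddCommGroup M] (φ : M →+ ℤ) (N : M → ℝ) (b : ℝ) (j : ℤ) : ℝ≥0∞ :=
  ∑' x, if φ x = j then ENNReal.ofReal (Real.exp (-b * N x)) else 0

lemma hE_mul {M : Type*} [AddCommGroup M] (φ : M →+ ℤ) (N : M → ℝ) (b : ℝ)
    (htf : ∀ x : M, x + x = 0 → x = 0)
    (hpar : ∀ x y, N (x + y) + N (x - y) = 2 * N x + 2 * N y) :
    ∃ Θ : M ⧸ (DistribMulAction.toAddMonoidEnd ℤ M 2 : M →+ M).range → ℤ → ℝ≥0∞,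
    ∀ j k, hE φ N b j * hE φ N b k = ∑' c, Θ c (j + k) * Θ c (j - k) := by
  classical
  set H := (DistribMulAction.toAddMonoidEnd ℤ M 2 : M →+ M).range with hH
  refine ⟨fun c m => ∑' p : M, if (QuotientAddGroup.mk p : M ⧸ H) = c then
    (if φ p = m then ENNReal.ofReal (Real.exp (-(b/2) * N p)) else 0) else 0, ?_⟩
  intro j k
  set F : ℤ → M → ℝ≥0∞ := fun m p =>
    if φ p = m then ENNReal.ofReal (Real.exp (-(b/2) * N p)) else 0 with hF
  have hR : (∑' c : M ⧸ H, (∑' p : M, if (QuotientAddGroup.mk p : M ⧸ H) = c then F (j+k) p else 0) *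
      (∑' q : M, if (QuotientAddGroup.mk q : M ⧸ H) = c then F (j-k) q else 0)) =
      ∑' pq : M × M, if (QuotientAddGroup.mk pq.1 : M ⧸ H) = QuotientAddGroup.mk pq.2 then
        F (j+k) pq.1 * F (j-k) pq.2 else 0 := by
    rw [ENNReal.tsum_prod (f := fun p q => if (QuotientAddGroup.mk p : M ⧸ H) = QuotientAddGroup.mk q then
        F (j+k) p * F (j-k) q else 0)]
    simp_rw [← ENNReal.tsum_mul_right, ← ENNReal.tsum_mul_left]
    rw [ENNReal.tsum_comm]
    refine tsum_congr fun p => ?_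
    rw [ENNReal.tsum_comm]
    refine tsum_congr fun q => ?_
    rw [tsum_eq_single (QuotientAddGroup.mk p : M ⧸ H)]
    · simp only [if_true, mul_ite, mul_zero, eq_comm]
    · intro c hc
      rw [if_neg (Ne.symm hc), zero_mul]
  rw [hR]
  let e : M × M → M × M := fun xy => (xy.1 + xy.2, xy.1 - xy.2)
  have he : Function.Injective e := by
    rintro ⟨x, y⟩ ⟨x', y'⟩ h
    simp only [e, Prod.mk.injEq] at h
    obtain ⟨h1, h2⟩ := h
    have hx : x = x' := by
      rw [← sub_eq_zero]
      apply htf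
      have : x - x' + (x - x') = (x + y) - (x' + y') + ((x - y) - (x' - y')) := by abel
      rw [this, h1, h2]; simp
    subst hx
    simpa using h1
  rw [← he.tsum_eq]
  · simp only [hE]
    simp_rw [← ENNReal.tsum_mul_right, ← ENNReal.tsum_mul_left]
    rw [← ENNReal.tsum_prod (f := fun x y => (if φ x = j then ENNReal.ofReal (Real.exp (-b * N x)) else 0) *
      (if φ y = k then ENNReal.ofReal (Real.exp (-b * N y)) else 0))]
    refine tsum_congr ?_
    rintro ⟨x, y⟩
    have hmk : (QuotientAddGroup.mk (x + y) : M ⧸ H) = QuotientAddGroup.mk (x - y) := by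
      rw [QuotientAddGroup.eq]
      refine ⟨-y, ?_⟩
      change (2 : ℤ) • (-y) = _
      rw [two_zsmul]; abel
    simp only [e, hmk, if_true, hF, map_add, map_sub]
    by_cases hx : φ x = j ∧ φ y = k
    · obtain ⟨hx, hy⟩ := hx
      simp only [hx, hy, if_true]
      rw [← ENNReal.ofReal_mul (Real.exp_nonneg _), ← ENNReal.ofReal_mul (Real.exp_nonneg _),
        ← Real.exp_add, ← Real.exp_add]
      congr 2
      linear_combination (b/2) * hpar x y
    · have h2 : ¬ (φ x + φ y = j + k ∧ φ x - φ y = j - k) := by omega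
      rw [not_and_or] at hx h2
      have hl : (if φ x = j then ENNReal.ofReal (Real.exp (-b * N x)) else 0) *
        (if φ y = k then ENNReal.ofReal (Real.exp (-b * N y)) else 0) = 0 := by
        rcases hx with h | h <;> simp [h]
      rw [hl]
      rcases h2 with h | h <;> simp [h]
  · rintro ⟨p, q⟩ hpq
    rw [Function.mem_support] at hpq
    have hmk : (QuotientAddGroup.mk p : M ⧸ H) = QuotientAddGroup.mk q := by
      by_contra hne
      exact hpq (if_neg hne)
    rw [QuotientAddGroup.eq] at hmk
    obtain ⟨y, hy⟩ := hmk
    change (2 : ℤ) • y = _ at hy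
    refine ⟨(p + y, -y), ?_⟩
    rw [two_zsmul] at hy
    simp only [e, Prod.mk.injEq]
    constructor
    · abel
    · rw [sub_neg_eq_add, add_assoc, hy]; abel

lemma hE_four {M : Type*} [AddCommGroup M] (φ : M →+ ℤ) (N : M → ℝ) (b : ℝ)
    (htf : ∀ x : M, x + x = 0 → x = 0)
    (hpar : ∀ x y, N (x + y) + N (x - y) = 2 * N x + 2 * N y) (j : ℤ) :
    hE φ N b j ^ 4 ≤ hE φ N b (2 * j) * hE φ N b 0 ^ 3 := by
  obtain ⟨Θ, h⟩ := hE_mul φ N b htf hpar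
  have h1 := h j j
  have h2 := h (2 * j) 0
  have h3 := h 0 0
  simp only [add_zero, sub_zero, sub_self, ← two_mul, mul_zero] at h1 h2 h3
  have := cs_tsum (fun c => Θ c (2 * j)) (fun c => Θ c 0)
  rw [← h1] at this
  simp only [sq (Θ _ _)] at this
  rw [← h2, ← h3] at this
  calc _ = _ := by ring
    _ ≤ _ := this
    _ = _ := by ring

lemma summable_pi_prod (f : ℤ → ℝ) (h0 : ∀ j, 0 ≤ f j) (hf : Summable f) (n : ℕ) :
    Summable fun z : Fin n → ℤ => ∏ i, f (z i) := by
  induction n with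
  | zero => exact Summable.of_finite
  | succ n ih =>
    rw [← (Fin.consEquiv (fun _ : Fin (n+1) => ℤ)).summable_iff]
    have := hf.mul_of_nonneg ih h0 (fun z => Finset.prod_nonneg fun i _ => h0 _)
    refine this.congr ?_
    rintro ⟨a, z⟩
    simp [Fin.prod_univ_succ, Fin.consEquiv]

lemma hasSum_int_geom (Q : ℝ) (h0 : 0 ≤ Q) (h1 : Q < 1) :
    HasSum (fun j : ℤ => Q ^ j.natAbs) ((1 + Q) / (1 - Q)) := by
  have hg := hasSum_geometric_of_lt_one h0 h1
  have h2 := HasSum.of_nat_of_neg_add_one (f := fun j : ℤ => Q ^ j.natAbs) (m := (1 - Q)⁻¹)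
    (m' := Q * (1 - Q)⁻¹) (by simpa using hg) (by
      have := hg.mul_left Q
      refine this.congr_fun ?_ |> fun h => h
      intro k
      have : (-((k:ℤ) + 1)).natAbs = k + 1 := by omega
      simp only [this, pow_succ']) 
  convert h2 using 1
  have : 1 - Q ≠ 0 := by linarith
  field_simp

lemma summable_exp_int (c : ℝ) (hc : 0 < c) : Summable fun j : ℤ => Real.exp (-c * (j:ℝ)^2) := by
  refine Summable.of_nonneg_of_le (fun _ => (Real.exp_nonneg _)) ?_
    (hasSum_int_geom (Real.exp (-c)) (Real.exp_nonneg _) (by simpa using hc)).summable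
  intro j
  rw [← Real.exp_nat_mul]
  apply Real.exp_le_exp.2
  have : ((j.natAbs : ℕ) : ℝ) ≤ (j:ℝ)^2 := by
    have : (j.natAbs : ℤ) ≤ j ^ 2 := by
      rw [← Int.natAbs_sq]; exact_mod_cast Nat.le_self_pow two_ne_zero _
    have h' : (((j.natAbs : ℕ) : ℤ) : ℝ) ≤ ((j ^ 2 : ℤ) : ℝ) := Int.cast_le.2 this
    rw [Int.cast_natCast] at h'
    push_cast at h'
    simpa using h'
  nlinarith

lemma fibre_bound {M : Type*} [AddCommGroup M] (φ : M →+ ℤ) (N : M → ℝ) (b K l : ℝ)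
    (htf : ∀ x : M, x + x = 0 → x = 0)
    (hpar : ∀ x y, N (x + y) + N (x - y) = 2 * N x + 2 * N y)
    (hl : 0 < l) (hbK : K * l < b)
    (hb : ∀ x, (φ x : ℝ) ^ 2 ≤ K * N x)
    (hN : ∀ x, 0 ≤ N x)
    (hS : ∀ c > 0, ∑' x, ENNReal.ofReal (Real.exp (-c * N x)) ≠ ∞) (hb0 : 0 < b) (j : ℤ) :
    hE φ N b j ≤ ENNReal.ofReal (Real.exp (-l) ^ j.natAbs) * hE φ N b 0 := by
  have hN0 : N 0 = 0 := by have := hpar 0 0; simp at this; linarith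
  have hfin : ∀ j, hE φ N b j ≠ ∞ := fun j => ne_top_of_le_ne_top (hS b hb0) <|
    ENNReal.tsum_le_tsum fun x => by split_ifs <;> simp
  have h01 : 1 ≤ hE φ N b 0 := by
    refine le_trans ?_ (ENNReal.le_tsum 0)
    simp [hN0]
  set a := (hE φ N b 0).toReal with ha
  have ha1 : 1 ≤ a := by
    have := ENNReal.toReal_mono (hfin 0) h01
    simpa using this
  set C := (∑' x, ENNReal.ofReal (Real.exp (-(b - K * l) * N x))) with hCdef
  have hC : C ≠ ∞ := hS _ (by linarith)
  have hup : ∀ j, (hE φ N b j).toReal ≤ Real.exp (-l * (j:ℝ)^2) * C.toReal := by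
    intro j
    have : hE φ N b j ≤ ENNReal.ofReal (Real.exp (-l * (j:ℝ)^2)) * C := by
      rw [hCdef, ← ENNReal.tsum_mul_left]
      refine ENNReal.tsum_le_tsum fun x => ?_
      split_ifs with h
      · rw [← ENNReal.ofReal_mul (Real.exp_nonneg _), ← Real.exp_add]
        apply ENNReal.ofReal_le_ofReal
        apply Real.exp_le_exp.2
        have := hb x
        rw [h] at this
        nlinarith
      · simp
    have := ENNReal.toReal_mono (ENNReal.mul_ne_top (by simp) hC) this
    rwa [ENNReal.toReal_mul, ENNReal.toReal_ofReal (Real.exp_nonneg _)] at this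
  have hG := aux_le_one (fun j => (hE φ N b j).toReal / a * Real.exp (l * (j:ℝ)^2)) C.toReal
    (fun j => by positivity) (fun j => by
      have h1 : (hE φ N b j).toReal / a ≤ (hE φ N b j).toReal :=
        div_le_self (by positivity) ha1
      calc _ ≤ (Real.exp (-l * (j:ℝ)^2) * C.toReal) * Real.exp (l * (j:ℝ)^2) := by
            gcongr; exact h1.trans (hup j)
        _ = (Real.exp (-l * (j:ℝ)^2) * Real.exp (l * (j:ℝ)^2)) * C.toReal := by ring
        _ = C.toReal := by rw [← Real.exp_add]; simp) (fun j => by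
      have h4 := ENNReal.toReal_mono (ENNReal.mul_ne_top (hfin _) (ENNReal.pow_ne_top (hfin _)))
        (hE_four φ N b htf hpar j)
      simp only [ENNReal.toReal_mul, ENNReal.toReal_pow, ← ha] at h4
      have he : Real.exp (l * ((2 * j : ℤ):ℝ)^2) = Real.exp (l * (j:ℝ)^2) ^ 4 := by
        rw [← Real.exp_nat_mul]; push_cast; congr 1; ring
      rw [he, mul_pow]
      gcongr
      rw [div_pow, div_le_div_iff₀ (by positivity) (by positivity)]
      calc _ ≤ ((hE φ N b (2 * j)).toReal * a ^ 3) * a := by gcongr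
        _ = _ := by ring) j
  have hfinal : (hE φ N b j).toReal ≤ Real.exp (-l) ^ j.natAbs * a := by
    have hh : (j.natAbs : ℝ) ≤ (j:ℝ)^2 := by
      have : (j.natAbs : ℤ) ≤ j ^ 2 := by
        rw [← Int.natAbs_sq]; exact_mod_cast Nat.le_self_pow two_ne_zero _
      have h' : (((j.natAbs : ℕ) : ℤ) : ℝ) ≤ ((j ^ 2 : ℤ) : ℝ) := Int.cast_le.2 this
      rw [Int.cast_natCast] at h'
      push_cast at h'
      simpa using h'
    have h1 : Real.exp (-(l * (j:ℝ)^2)) ≤ Real.exp (-l) ^ j.natAbs := by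
      rw [← Real.exp_nat_mul]
      apply Real.exp_le_exp.2
      nlinarith
    refine le_trans ?_ (mul_le_mul_of_nonneg_right h1 (by positivity))
    rw [Real.exp_neg]
    have := Real.exp_pos (l * (j:ℝ)^2)
    rw [div_mul_eq_mul_div, div_le_one (by positivity)] at hG
    rw [inv_mul_eq_div, le_div_iff₀ this]
    exact hG
  rw [← ENNReal.ofReal_toReal (hfin j), ← ENNReal.ofReal_toReal (hfin 0),
    ← ENNReal.ofReal_mul (by positivity)]
  exact ENNReal.ofReal_le_ofReal hfinal

lemma off_bound {M : Type*} [AddCommGroup M] (φ : M →+ ℤ) (N : M → ℝ) (b K l : ℝ)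
    (htf : ∀ x : M, x + x = 0 → x = 0)
    (hpar : ∀ x y, N (x + y) + N (x - y) = 2 * N x + 2 * N y)
    (hl : 0 < l) (hbK : K * l < b)
    (hb : ∀ x, (φ x : ℝ) ^ 2 ≤ K * N x)
    (hN : ∀ x, 0 ≤ N x)
    (hS : ∀ c > 0, ∑' x, ENNReal.ofReal (Real.exp (-c * N x)) ≠ ∞) (hb0 : 0 < b) :
    (∑' x, if φ x ≠ 0 then ENNReal.ofReal (Real.exp (-b * N x)) else 0).toReal ≤
      2 * Real.exp (-l) * (∑' x, ENNReal.ofReal (Real.exp (-b * N x))).toReal := by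
  have hT := hS b hb0
  set T := ∑' x, ENNReal.ofReal (Real.exp (-b * N x)) with hTd
  set A := ∑' x, if φ x ≠ 0 then ENNReal.ofReal (Real.exp (-b * N x)) else 0 with hAd
  have hTA : T = hE φ N b 0 + A := by
    rw [hTd, hAd, hE, ← ENNReal.tsum_add]
    refine tsum_congr fun x => ?_
    by_cases h : φ x = 0 <;> simp [h]
  have hsum : T = ∑' j, hE φ N b j := by
    simp only [hE]
    rw [ENNReal.tsum_comm]
    refine tsum_congr fun x => ?_
    rw [tsum_eq_single (φ x)]
    · simp
    · intro j hj; exact if_neg (Ne.symm hj)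
  set Q := Real.exp (-l) with hQ
  have hQ0 : 0 < Q := Real.exp_pos _
  have hQ1 : Q < 1 := by simpa [hQ] using hl
  have hgeo := hasSum_int_geom Q hQ0.le hQ1
  have hle : T ≤ ENNReal.ofReal ((1 + Q) / (1 - Q)) * hE φ N b 0 := by
    rw [← hgeo.tsum_eq, ENNReal.ofReal_tsum_of_nonneg (fun j => by positivity) hgeo.summable,
      ← ENNReal.tsum_mul_right, hsum]
    exact ENNReal.tsum_le_tsum fun j => fibre_bound φ N b K l htf hpar hl hbK hb hN hS hb0 j
  have hf0 : hE φ N b 0 ≠ ∞ := ne_top_of_le_ne_top hT (hTA ▸ le_self_add)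
  have hfA : A ≠ ∞ := ne_top_of_le_ne_top hT (hTA ▸ le_add_self)
  have h1 := ENNReal.toReal_mono (ENNReal.mul_ne_top (by simp) hf0) hle
  have h2 := congrArg ENNReal.toReal hTA
  rw [ENNReal.toReal_add hf0 hfA] at h2
  rw [ENNReal.toReal_mul, ENNReal.toReal_ofReal (div_nonneg (by linarith) (by linarith)),
    div_mul_eq_mul_div, le_div_iff₀ (by linarith)] at h1
  have : 0 ≤ T.toReal := ENNReal.toReal_nonneg
  have : 0 ≤ A.toReal := ENNReal.toReal_nonneg
  nlinarith [mul_nonneg hQ0.le this]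

lemma core {M : Type*} [AddCommGroup M] (N : M → ℝ) (n : ℕ) (hn : 0 < n) (φ : Fin n → M →+ ℤ)
    (hpar : ∀ x y, N (x + y) + N (x - y) = 2 * N x + 2 * N y)
    (hφ : ∀ x : M, (∀ i, φ i x = 0) → x = 0) (K : ℝ) (hK : 0 < K)
    (hb : ∀ i x, (φ i x : ℝ) ^ 2 ≤ K * N x) (ε : ℝ) (hε : 0 < ε) (b : ℝ)
    (hbK : K * Real.log (2 * n * (1 + 1 / ε)) < b) :
    ∑' x : {x : M // x ≠ 0}, Real.exp (-b * N x) ≤ ε := by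
  classical
  have hn1 : (1:ℝ) ≤ n := by exact_mod_cast hn
  set P := 2 * n * (1 + 1 / ε) with hP
  have he : 0 < 1 / ε := by positivity
  have hP1 : 1 < P := by rw [hP]; nlinarith
  set l := Real.log P with hl
  have hl0 : 0 < l := Real.log_pos hP1
  have hb0 : 0 < b := lt_trans (by positivity) hbK
  have hN : ∀ x, 0 ≤ N x := fun x => by
    have := hb ⟨0, hn⟩ x
    have h2 := sq_nonneg (φ ⟨0, hn⟩ x : ℝ)
    exact nonneg_of_mul_nonneg_right (h2.trans this) hK
  have hN0 : N 0 = 0 := by have := hpar 0 0; simp at this; linarith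
  have htf : ∀ x : M, x + x = 0 → x = 0 := by
    intro x hx
    apply hφ
    intro i
    have := congrArg (φ i) hx
    simp at this
    omega
  have hinj : Function.Injective (fun (x : M) (i : Fin n) => φ i x) := by
    intro x y hxy
    rw [← sub_eq_zero]
    apply hφ
    intro i
    have := congrFun hxy i
    simp only at this
    simp [this]
  have hSum : ∀ c > 0, Summable fun x => Real.exp (-c * N x) := by
    intro c hc
    have h1 := (summable_pi_prod _ (fun j => (Real.exp_nonneg _))
      (summable_exp_int (c / (n * K)) (by positivity)) n).comp_injective hinj
    refine Summable.of_nonneg_of_le (fun _ => (Real.exp_nonneg _)) (fun x => ?_) h1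
    simp only [Function.comp]
    rw [← Real.exp_sum]
    apply Real.exp_le_exp.2
    rw [← Finset.mul_sum]
    have h2 : ∑ i, (φ i x : ℝ) ^ 2 ≤ n * (K * N x) := by
      calc _ ≤ ∑ i : Fin n, K * N x := Finset.sum_le_sum fun i _ => hb i x
        _ = _ := by simp
    have h3 : c / (n * K) * ∑ i, (φ i x : ℝ) ^ 2 ≤ c / (n * K) * (n * (K * N x)) := by gcongr
    have h4 : c / (n * K) * (n * (K * N x)) = c * N x := by
      field_simp
    linarith
  have hS : ∀ c > 0, ∑' x, ENNReal.ofReal (Real.exp (-c * N x)) ≠ ∞ := by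
    intro c hc
    rw [← ENNReal.ofReal_tsum_of_nonneg (fun _ => Real.exp_nonneg _) (hSum c hc)]
    simp
  set T := ∑' x, ENNReal.ofReal (Real.exp (-b * N x)) with hTd
  have hT : T ≠ ∞ := hS b hb0
  set A : Fin n → ℝ≥0∞ := fun i =>
    ∑' x, if φ i x ≠ 0 then ENNReal.ofReal (Real.exp (-b * N x)) else 0 with hA
  have hAT : ∀ i, A i ≠ ∞ := fun i => ne_top_of_le_ne_top hT <|
    ENNReal.tsum_le_tsum fun x => by split_ifs <;> simp
  set R := ∑' x : {x : M // x ≠ 0}, ENNReal.ofReal (Real.exp (-b * N x)) with hR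
  have hR' : R = ∑' x : M, if x ≠ 0 then ENNReal.ofReal (Real.exp (-b * N x)) else 0 := by
    rw [hR]
    have := tsum_subtype {x : M | x ≠ 0} (fun x => ENNReal.ofReal (Real.exp (-b * N x)))
    refine Eq.trans this ?_
    refine tsum_congr fun x => ?_
    simp [Set.indicator]
  have hTR : T = 1 + R := by
    have h1 : (1 : ℝ≥0∞) = ∑' x : M, if x = 0 then ENNReal.ofReal (Real.exp (-b * N x)) else 0 := by
      rw [tsum_eq_single 0]
      · simp [hN0]
      · intro x hx; simp [hx]
    rw [h1, hR', ← ENNReal.tsum_add]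
    refine tsum_congr fun x => ?_
    by_cases h : x = 0 <;> simp [h]
  have hRA : R ≤ ∑ i, A i := by
    rw [hR', ← tsum_fintype (L := .unconditional _), ENNReal.tsum_comm]
    refine ENNReal.tsum_le_tsum fun x => ?_
    split_ifs with h
    · obtain ⟨i, hi⟩ : ∃ i, φ i x ≠ 0 := by
        by_contra! hh
        exact h (hφ x hh)
      refine le_trans ?_ (ENNReal.le_tsum i)
      simp [hi]
    · simp
  have hRT : R ≠ ∞ := ne_top_of_le_ne_top hT (hTR ▸ le_add_self)
  have hA2 : ∀ i, (A i).toReal ≤ 2 * Real.exp (-l) * T.toReal := fun i =>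
    off_bound (φ i) N b K l htf hpar hl0 hbK (hb i) hN hS hb0
  have h1 := ENNReal.toReal_mono (by simpa using hAT) hRA
  rw [ENNReal.toReal_sum (fun i _ => hAT i)] at h1
  have h2 : ∑ i, (A i).toReal ≤ n * (2 * Real.exp (-l) * T.toReal) := by
    calc _ ≤ ∑ i : Fin n, _ := Finset.sum_le_sum fun i _ => hA2 i
      _ = _ := by simp
  have h3 : T.toReal = 1 + R.toReal := by
    rw [hTR, ENNReal.toReal_add (by simp) hRT]; simp
  have hQ : n * (2 * Real.exp (-l)) = ε / (1 + ε) := by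
    rw [Real.exp_neg, hl, Real.exp_log (by linarith), hP]
    field_simp
    ring
  have h4 : R.toReal = ∑' x : {x : M // x ≠ 0}, Real.exp (-b * N x) := by
    rw [hR, ENNReal.tsum_toReal_eq (by simp)]
    refine tsum_congr fun x => ENNReal.toReal_ofReal (Real.exp_nonneg _)
  rw [← h4]
  have h5 : R.toReal ≤ ε / (1 + ε) * (1 + R.toReal) := by
    rw [← hQ, ← h3]; linarith
  rw [div_mul_eq_mul_div, le_div_iff₀ (by linarith)] at h5
  nlinarith

def dualGroup {n : ℕ} (B : Matrix (Fin n) (Fin n) ℝ) : AddSubgroup (Fin n → ℝ) where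
  carrier := dualLattice B
  zero_mem' := fun v _ => ⟨0, by simp⟩
  add_mem' := by
    intro x y hx hy v hv
    obtain ⟨k, hk⟩ := hx v hv
    obtain ⟨m, hm⟩ := hy v hv
    exact ⟨k + m, by simp [add_mul, Finset.sum_add_distrib, hk, hm]⟩
  neg_mem' := by
    intro x hx v hv
    obtain ⟨k, hk⟩ := hx v hv
    exact ⟨-k, by simp [hk]⟩

def pairHom {n : ℕ} (B : Matrix (Fin n) (Fin n) ℝ) (v : Fin n → ℝ) (hv : v ∈ latticeSet B) :
    dualGroup B →+ ℤ :=
  AddMonoidHom.mk' (fun x => Classical.choose (x.2 v hv)) (by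
    intro x y
    have h1 := Classical.choose_spec (x.2 v hv)
    have h2 := Classical.choose_spec (y.2 v hv)
    have h3 := Classical.choose_spec ((x + y).2 v hv)
    apply Int.cast_injective (α := ℝ)
    push_cast
    rw [← h1, ← h2, ← h3]
    simp [add_mul, Finset.sum_add_distrib])

lemma pairHom_spec {n : ℕ} (B : Matrix (Fin n) (Fin n) ℝ) (v : Fin n → ℝ)
    (hv : v ∈ latticeSet B) (x : dualGroup B) :
    (pairHom B v hv x : ℝ) = ∑ i, (x : Fin n → ℝ) i * v i :=
  (Classical.choose_spec (x.2 v hv)).symm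

lemma smoothing_le {n : ℕ} (hn : 0 < n) (B : Matrix (Fin n) (Fin n) ℝ) (ε : ℝ) (hε : 0 < ε)
    (r : ℝ) (v : Fin n → (Fin n → ℝ)) (hv : LinearIndependent ℝ v)
    (hvr : ∀ i, v i ∈ latticeSet B ∧ enorm2 (v i) ≤ r) :
    smoothingParam B ε ≤ Real.sqrt (Real.log (2 * n * (1 + 1 / ε)) / π) * r := by
  have hr : 0 < r := by
    refine lt_of_lt_of_le ?_ (hvr ⟨0, hn⟩).2
    have hne := hv.ne_zero ⟨0, hn⟩
    obtain ⟨k, hk⟩ := Function.ne_iff.1 hne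
    apply Real.sqrt_pos.2
    exact Finset.sum_pos' (fun _ _ => sq_nonneg _) ⟨k, Finset.mem_univ _, by
      have : v ⟨0, hn⟩ k ≠ 0 := hk
      positivity⟩
  have hv2 : ∀ i, ∑ k, v i k ^ 2 ≤ r ^ 2 := fun i => (Real.sqrt_le_left hr.le).1 (hvr i).2
  have hn1 : (1:ℝ) ≤ n := by exact_mod_cast hn
  have he : 0 < 1 / ε := by positivity
  have hl0 : 0 < Real.log (2 * n * (1 + 1 / ε)) := Real.log_pos (by nlinarith)
  set l := Real.log (2 * n * (1 + 1 / ε)) with hl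
  refine le_of_forall_gt_imp_ge_of_dense fun s hs => ?_
  have hs0 : 0 < s := lt_of_le_of_lt (by positivity) hs
  refine csInf_le ⟨0, fun s hs => hs.1.le⟩ ⟨hs0, ?_⟩
  have hbK : r ^ 2 * l < π * s ^ 2 := by
    have h1 := pow_lt_pow_left₀ hs (by positivity) two_ne_zero
    rw [mul_pow, Real.sq_sqrt (by positivity), div_mul_eq_mul_div,
      div_lt_iff₀ Real.pi_pos] at h1
    linarith
  have hc := core (M := dualGroup B) (fun x => ∑ i, (x : Fin n → ℝ) i ^ 2) n hn
    (fun i => pairHom B (v i) (hvr i).1)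
    (by
      intro x y
      simp only [AddSubgroup.coe_add, AddSubgroup.coe_sub, Pi.add_apply, Pi.sub_apply,
        Finset.mul_sum, ← Finset.sum_add_distrib]
      exact Finset.sum_congr rfl fun i _ => by ring)
    (by
      intro x hx
      have hu : IsUnit (Matrix.of v) := Matrix.linearIndependent_rows_iff_isUnit.1 hv
      have hi := Matrix.mulVec_injective_of_isUnit hu
      apply Subtype.ext
      apply hi
      ext i
      have := pairHom_spec B (v i) (hvr i).1 x
      rw [hx i] at this
      simp only [Int.cast_zero] at this
      simp only [Matrix.mulVec, dotProduct, Matrix.of_apply]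
      simp [mul_comm (v i _), ← this])
    (r ^ 2) (by positivity)
    (by
      intro i x
      rw [pairHom_spec]
      refine (Finset.sum_mul_sq_le_sq_mul_sq _ _ _).trans ?_
      rw [mul_comm]
      gcongr
      exact hv2 i)
    ε hε (π * s ^ 2) hbK
  refine le_trans (le_of_eq ?_) hc
  unfold rhoOnSet
  let e : {x : dualGroup B // x ≠ 0} ≃ ↑(dualLattice B \ {0}) :=
    { toFun := fun x => ⟨x.1.1, x.1.2, fun h => x.2 (Subtype.ext h)⟩
      invFun := fun x => ⟨⟨x.1, x.2.1⟩, fun h => x.2.2 (congrArg Subtype.val h)⟩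
      left_inv := fun x => rfl
      right_inv := fun x => rfl }
  rw [← e.tsum_eq]
  refine tsum_congr fun x => ?_
  congr 1
  simp only [e, Equiv.coe_fn_mk]
  field_simp

theorem stmt9 (n : ℕ) (B : Matrix (Fin n) (Fin n) ℝ) (hB : IsUnit B.det)
    (ε : ℝ) (hε : 0 < ε) :
    smoothingParam B ε ≤
      Real.sqrt (Real.log (2 * n * (1 + 1 / ε)) / π) * lambdaN B := by
  rcases Nat.eq_zero_or_pos n with rfl | hn
  · simp only [Nat.cast_zero, mul_zero, zero_mul, Real.log_zero, zero_div, Real.sqrt_zero]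
    refine le_of_forall_gt_imp_ge_of_dense fun s hs => ?_
    refine csInf_le ⟨0, fun s hs => hs.1.le⟩ ⟨hs, ?_⟩
    have : IsEmpty ↑(dualLattice B \ {0}) := ⟨fun x => x.2.2 (Subsingleton.elim _ _)⟩
    unfold rhoOnSet
    rw [tsum_empty]
    exact hε.le
  · have hne : {r : ℝ | ∃ v : Fin n → (Fin n → ℝ),
      LinearIndependent ℝ v ∧ ∀ i, v i ∈ latticeSet B ∧ enorm2 (v i) ≤ r}.Nonempty := by
      refine ⟨∑ i, enorm2 (B.col i), B.col, ?_, fun i => ⟨⟨Pi.single i 1, ?_⟩, ?_⟩⟩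
      · exact Matrix.linearIndependent_cols_iff_isUnit.2 ((Matrix.isUnit_iff_isUnit_det B).2 hB)
      · have : (fun k => ((Pi.single i 1 : Fin n → ℤ) k : ℝ)) = Pi.single i 1 := by
          ext k
          by_cases h : k = i
          · subst h; simp
          · simp [h]
        rw [this, Matrix.mulVec_single_one]
      · exact Finset.single_le_sum (f := fun i => enorm2 (B.col i))
          (fun i _ => Real.sqrt_nonneg _) (Finset.mem_univ i)
    set c := Real.sqrt (Real.log (2 * n * (1 + 1 / ε)) / π) with hc
    have hn1 : (1:ℝ) ≤ n := by exact_mod_cast hn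
    have he : 0 < 1 / ε := by positivity
    have hl0 : 0 < Real.log (2 * n * (1 + 1 / ε)) := Real.log_pos (by nlinarith)
    have hc0 : 0 < c := Real.sqrt_pos.2 (by positivity)
    rw [← div_le_iff₀' hc0]
    refine le_csInf hne ?_
    rintro r ⟨v, hv, hvr⟩
    rw [div_le_iff₀' hc0]
    exact smoothing_le hn B ε hε r v hv hvr

end
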